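/- Any Cauchy sequence of barcodes in B_N (barcodes with at most N intervals) converges in the bottleneck metric to a barcode in B_N. -/

import Mathlib

open scoped ENNReal

/-- `(a,b)` represents the half-open interval `[a,b)` with `0 ≤ a < b < ∞`. -/
def IsBarInterval (p : ℝ × ℝ) : Prop := 0 ≤ p.1 ∧ p.1 < p.2

/-- An element of the extended barcode space `B̄`: a multiset of intervals `[a,b)`
(recorded by its multiplicity function) such that for every `ε > 0` only finitely many
intervals (with multiplicity, each multiplicity being finite) have length `> ε`. -/
structure ExtBarcode where
  mult : ℝ × ℝ → ℕ
  isInterval : ∀ p, mult p ≠ 0 → IsBarInterval p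
  finite_long : ∀ ε : ℝ, 0 < ε → {p | mult p ≠ 0 ∧ ε < p.2 - p.1}.Finite

/-- The `d_∞` cost of matching two (possibly empty) intervals:
`d_∞([a,b),[c,d)) = max (|a-c|, |b-d|)`, `d_∞([a,b),∅) = (b-a)/2`, `d_∞(∅,∅) = 0`. -/
noncomputable def optCost : Option (ℝ × ℝ) → Option (ℝ × ℝ) → ℝ≥0∞
  | some p, some q => ENNReal.ofReal (max |p.1 - q.1| |p.2 - q.2|)
  | some p, none => ENNReal.ofReal ((p.2 - p.1) / 2)
  | none, some q => ENNReal.ofReal ((q.2 - q.1) / 2)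
  | none, none => 0

/-- A matching between two barcodes: a multiset of pairs from `(B₁ ∪ {∅}) × (B₂ ∪ {∅})`,
not containing `(∅,∅)`, in which each interval of `B₁` appears as a first coordinate
with its multiplicity, and each interval of `B₂` as a second coordinate with its
multiplicity. -/
structure BMatching (A B : ExtBarcode) where
  m : Option (ℝ × ℝ) × Option (ℝ × ℝ) → ℕ
  not_both_empty : m (none, none) = 0
  left : ∀ p : ℝ × ℝ, ∑' q : Option (ℝ × ℝ), (m (some p, q) : ℝ≥0∞) = A.mult p
  right : ∀ q : ℝ × ℝ, ∑' p : Option (ℝ × ℝ), (m (p, some q) : ℝ≥0∞) = B.mult q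

/-- The cost of a matching: the sup of `d_∞` over the pairs occurring in it. -/
noncomputable def BMatching.cost {A B : ExtBarcode} (C : BMatching A B) : ℝ≥0∞ :=
  ⨆ c ∈ {c | C.m c ≠ 0}, optCost c.1 c.2

/-- The bottleneck distance `d_B`: infimum of the costs of matchings. -/
noncomputable def bottleneckDist (A B : ExtBarcode) : ℝ≥0∞ :=
  ⨅ C : BMatching A B, C.cost

/-- Total number of intervals of a barcode, counted with multiplicity. -/
noncomputable def ExtBarcode.card (A : ExtBarcode) : ℝ≥0∞ := ∑' p : ℝ × ℝ, (A.mult p : ℝ≥0∞)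

/-- Membership in `B_N`: at most `N` intervals (counted with multiplicity). -/
def ExtBarcode.memBN (N : ℕ) (A : ExtBarcode) : Prop := A.card ≤ N

/-- A barcode is finite (lies in `B = ⋃ B_N`) if it has finitely many intervals. -/
def ExtBarcode.IsFinite (A : ExtBarcode) : Prop := {p | A.mult p ≠ 0}.Finite

theorem ENNReal.tsum_option {α : Type*} (f : Option α → ℝ≥0∞) :
    ∑' x, f x = f none + ∑' a, f (some a) := by
  rw [← (Equiv.optionEquivSumPUnit.{0} α).symm.tsum_eq f,
    Summable.tsum_sum ENNReal.summable ENNReal.summable, add_comm]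
  simp

open Finset in
/-- The fibres of a labelling partition the labelled elements. -/
theorem ENNReal.tsum_card_filter_eq_some {ι α : Type*} [DecidableEq α] (s : Finset ι)
    (F : ι → Option α) :
    ∑' a, (#{i ∈ s | F i = some a} : ℝ≥0∞) = #{i ∈ s | (F i).isSome} := by
  simp only [card_filter, Nat.cast_sum]
  rw [Summable.tsum_finsetSum fun _ _ => ENNReal.summable]
  refine sum_congr rfl fun i _ => ?_
  cases h : F i with
  | none => simp
  | some b => simp [Nat.cast_ite]

open Finset in
/-- The fibres of a function on a finite set partition it. -/
theorem ENNReal.tsum_card_filter_eq {ι α : Type*} [DecidableEq α] (s : Finset ι) (F : ι → α) :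
    ∑' a, (#{i ∈ s | F i = a} : ℝ≥0∞) = #s := by
  simpa using ENNReal.tsum_card_filter_eq_some s fun i => some (F i)

open Finset in
/-- Partial labelling of a finite set with prescribed multiplicities. -/
theorem exists_partial_labelling {ι α : Type*} [DecidableEq α] (s : Finset ι) (w : α → ℕ)
    (hw : ∑' a, (w a : ℝ≥0∞) ≤ #s) :
    ∃ R : ι → Option α, ∀ a, #{i ∈ s | R i = some a} = w a := by
  classical
  have hfin : {a | 1 ≤ (w a : ℝ≥0∞)}.Finite :=
    ENNReal.finite_const_le_of_tsum_ne_top (ne_top_of_le_ne_top (by simp) hw) one_ne_zero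
  set t := hfin.toFinset
  have ht : ∀ a, w a ≠ 0 → a ∈ t := fun a ha => by
    simpa [t] using Nat.one_le_iff_ne_zero.2 ha
  have hsum : ∑ a ∈ t, w a ≤ #s := by
    have := (ENNReal.sum_le_tsum t).trans hw
    exact_mod_cast this
  have hcard : Fintype.card (Σ a : t, Fin (w a)) ≤ Fintype.card s := by
    rw [Fintype.card_sigma, Fintype.card_coe]
    simpa only [Fintype.card_fin, sum_coe_sort t w] using hsum
  obtain ⟨e⟩ := Function.Embedding.nonempty_of_card_le hcard
  have key : ∀ x y, (e x : ι) = e y ↔ x = y := fun x y => by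
    rw [Subtype.coe_inj, e.injective.eq_iff]
  refine ⟨fun i => if h : ∃ x, (e x : ι) = i then some h.choose.1 else none, fun a => ?_⟩
  have hR : ∀ i, (if h : ∃ x, (e x : ι) = i then some (h.choose.1 : α) else none) = some a ↔
      ∃ x, (e x : ι) = i ∧ x.1 = a := by
    intro i
    split_ifs with h
    · have hc := h.choose_spec
      constructor
      · intro h'
        exact ⟨_, hc, by simpa using h'⟩
      · rintro ⟨x, hx, rfl⟩
        rw [(key _ _).1 (hc.trans hx.symm)]
    · refine iff_of_false nofun ?_
      rintro ⟨x, hx, -⟩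
      exact h ⟨x, hx⟩
  simp only [hR]
  by_cases ha : a ∈ t
  · have : {i ∈ s | ∃ x, (e x : ι) = i ∧ (x.1 : α) = a} =
        univ.image fun k : Fin (w a) => (e ⟨⟨a, ha⟩, k⟩ : ι) := by
      ext i
      simp only [mem_filter, mem_image, mem_univ, true_and]
      constructor
      · rintro ⟨-, ⟨⟨b, hb⟩, k⟩, rfl, rfl⟩
        exact ⟨k, rfl⟩
      · rintro ⟨k, rfl⟩
        exact ⟨(e _).2, _, rfl, rfl⟩
    rw [this, card_image_of_injective _ fun k l h => by simpa using (key _ _).1 h]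
    simp
  · have h0 : w a = 0 := by_contra fun h => ha (ht a h)
    rw [h0, card_eq_zero, filter_eq_empty_iff]
    rintro i - ⟨x, -, rfl⟩
    exact ha x.1.2

/-- The family `F` lists the intervals of `A` with multiplicity, `none` being a blank entry. -/
def ExtBarcode.IsListedBy {ι : Type*} [Fintype ι] (A : ExtBarcode) (F : ι → Option (ℝ × ℝ)) :
    Prop :=
  ∀ p, A.mult p = Finset.card {i | F i = some p}

/-- Two entries are `ε`-close if they may be matched at cost `ε`, or both left unmatched. -/
def OptClose (ε : ℝ≥0∞) (x y : Option (ℝ × ℝ)) : Prop :=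
  optCost x y ≤ ε ∨ optCost x none ≤ ε ∧ optCost none y ≤ ε

theorem optCost_comm (x y : Option (ℝ × ℝ)) : optCost x y = optCost y x := by
  cases x <;> cases y <;> simp [optCost, abs_sub_comm]

theorem optCost_none_none : optCost none none = 0 := rfl

theorem optCost_some_some (p q : ℝ × ℝ) : optCost (some p) (some q) = edist p q := by
  rw [edist_dist, Prod.dist_eq]; rfl

theorem optCost_none_triangle (x y : Option (ℝ × ℝ)) :
    optCost x none ≤ optCost x y + optCost y none := by
  rcases x with - | p <;> rcases y with - | q
  · simp [optCost]
  · simp [optCost]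
  · simp [optCost]
  · refine le_trans (ENNReal.ofReal_le_ofReal ?_) ENNReal.ofReal_add_le
    have h1 := neg_abs_le (p.1 - q.1)
    have h2 := le_abs_self (p.2 - q.2)
    have h3 := le_max_left |p.1 - q.1| |p.2 - q.2|
    have h4 := le_max_right |p.1 - q.1| |p.2 - q.2|
    linarith

theorem OptClose.symm {ε : ℝ≥0∞} {x y : Option (ℝ × ℝ)} (h : OptClose ε x y) :
    OptClose ε y x := by
  simpa only [OptClose, optCost_comm, and_comm] using h

theorem OptClose.refl (ε : ℝ≥0∞) (x : Option (ℝ × ℝ)) : OptClose ε x x := by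
  left
  cases x <;> simp [optCost]

theorem OptClose.mono {ε δ : ℝ≥0∞} {x y : Option (ℝ × ℝ)} (h : OptClose ε x y) (hεδ : ε ≤ δ) :
    OptClose δ x y :=
  h.imp (·.trans hεδ) fun h => ⟨h.1.trans hεδ, h.2.trans hεδ⟩

theorem OptClose.trans {ε δ : ℝ≥0∞} {x y z : Option (ℝ × ℝ)} (hxy : OptClose ε x y)
    (hyz : OptClose δ y z) : OptClose (ε + δ) x z := by
  rcases hxy with hxy | ⟨hx, hy⟩ <;> rcases hyz with hyz | ⟨hy', hz⟩
  · rcases y with - | q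
    · exact .inr ⟨hxy.trans le_self_add, hyz.trans le_add_self⟩
    rcases x with - | p
    · left
      rw [optCost_comm] at hxy hyz ⊢
      exact (optCost_none_triangle _ _).trans ((add_le_add hyz hxy).trans (add_comm _ _).le)
    rcases z with - | r
    · exact .inl ((optCost_none_triangle _ _).trans (add_le_add hxy hyz))
    · left
      rw [optCost_some_some] at *
      exact (edist_triangle p q r).trans (add_le_add hxy hyz)
  · exact .inr ⟨(optCost_none_triangle x y).trans (add_le_add hxy hy'), hz.trans le_add_self⟩
  · refine .inr ⟨hx.trans le_self_add, ?_⟩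
    rw [optCost_comm] at hy hyz ⊢
    exact (optCost_none_triangle z y).trans ((add_le_add hyz hy).trans (add_comm _ _).le)
  · exact .inr ⟨hx.trans le_self_add, hz.trans le_add_self⟩

open Finset in
/-- A finite family of pairs listing `A` and `B` in its coordinates bounds the bottleneck
distance. -/
theorem bottleneckDist_le_of_pairs {ι : Type*} [Fintype ι] {A B : ExtBarcode} {ε : ℝ≥0∞}
    (P : ι → Option (ℝ × ℝ) × Option (ℝ × ℝ)) (hA : A.IsListedBy fun i => (P i).1)
    (hB : B.IsListedBy fun i => (P i).2) (hP : ∀ i, optCost (P i).1 (P i).2 ≤ ε) :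
    bottleneckDist A B ≤ ε := by
  let C : BMatching A B :=
    { m := fun c => if c = (none, none) then 0 else #{i | P i = c}
      not_both_empty := by simp
      left := fun p => by
        rw [hA p, ← ENNReal.tsum_card_filter_eq _ fun i => (P i).2]
        refine tsum_congr fun q => ?_
        simp [filter_filter, Prod.ext_iff]
      right := fun q => by
        rw [hB q, ← ENNReal.tsum_card_filter_eq _ fun i => (P i).1]
        refine tsum_congr fun p => ?_
        simp [filter_filter, Prod.ext_iff, and_comm] }
  refine (iInf_le _ C).trans (iSup₂_le fun c hc => ?_)
  have hc' : #{i | P i = c} ≠ 0 := fun h => hc (by simp [C, h])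
  obtain ⟨i, hi⟩ := card_ne_zero.1 hc'
  rw [mem_filter_univ] at hi
  exact hi ▸ hP i

open Finset in
theorem bottleneckDist_le_of_optClose {ι : Type*} [Fintype ι] {A B : ExtBarcode} {ε : ℝ≥0∞}
    {F G : ι → Option (ℝ × ℝ)} (hF : A.IsListedBy F) (hG : B.IsListedBy G)
    (h : ∀ i, OptClose ε (F i) (G i)) : bottleneckDist A B ≤ ε := by
  classical
  refine bottleneckDist_le_of_pairs
    (Sum.elim (fun i => if optCost (F i) (G i) ≤ ε then (F i, G i) else (F i, none))
      fun i => if optCost (F i) (G i) ≤ ε then (none, none) else (none, G i)) ?_ ?_ ?_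
  · intro p
    rw [hF p, card_filter, card_filter, Fintype.sum_sum_type]
    simp only [Sum.elim_inl, Sum.elim_inr, apply_ite Prod.fst, ite_self]
    simp
  · intro q
    rw [hG q, card_filter, card_filter, Fintype.sum_sum_type, ← sum_add_distrib]
    refine sum_congr rfl fun i _ => ?_
    by_cases hi : optCost (F i) (G i) ≤ ε <;> simp [hi]
  · rintro (i | i) <;> by_cases hi : optCost (F i) (G i) ≤ ε
    · simp [hi]
    · simpa [hi] using ((h i).resolve_left hi).1
    · simp [hi, optCost_none_none]
    · simpa [hi] using ((h i).resolve_left hi).2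

theorem ExtBarcode.memBN.exists_isListedBy {N : ℕ} {A : ExtBarcode} (hA : A.memBN N) :
    ∃ F : Fin N → Option (ℝ × ℝ), A.IsListedBy F := by
  obtain ⟨F, hF⟩ := exists_partial_labelling (Finset.univ : Finset (Fin N)) A.mult
    (by simpa [ExtBarcode.memBN, ExtBarcode.card] using hA)
  exact ⟨F, fun p => (hF p).symm⟩

theorem ExtBarcode.IsListedBy.isBarInterval {ι : Type*} [Fintype ι] {A : ExtBarcode}
    {F : ι → Option (ℝ × ℝ)} (hF : A.IsListedBy F) {i : ι} {p : ℝ × ℝ} (hi : F i = some p) :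
    IsBarInterval p := by
  refine A.isInterval p ?_
  rw [hF p]
  exact Finset.card_ne_zero.2 ⟨i, by simpa using hi⟩

open Finset in
/-- A listing of `A` can be transported along a matching to a close listing of `B`. -/
theorem ExtBarcode.IsListedBy.exists_optClose {N : ℕ} {A B : ExtBarcode} {ε : ℝ≥0∞}
    {F : Fin N → Option (ℝ × ℝ)} (hF : A.IsListedBy F) (hB : B.memBN N)
    (hAB : bottleneckDist A B < ε) :
    ∃ G : Fin N → Option (ℝ × ℝ), B.IsListedBy G ∧ ∀ i, OptClose ε (F i) (G i) := by
  obtain ⟨C, hC⟩ := iInf_lt_iff.1 hAB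
  have hcost : ∀ x y, C.m (x, y) ≠ 0 → optCost x y ≤ ε := fun x y h =>
    (le_iSup₂_of_le (f := fun c (_ : c ∈ {c | C.m c ≠ 0}) => optCost c.1 c.2)
      (x, y) h le_rfl).trans hC.le
  have hleft : ∀ p, (C.m (some p, none) : ℝ≥0∞) + ∑' q, (C.m (some p, some q) : ℝ≥0∞) =
      #{i | F i = some p} := fun p => by
    rw [← hF p, ← C.left p, ENNReal.tsum_option]
  choose R hR using fun p => exists_partial_labelling ({i | F i = some p} : Finset (Fin N))
    (fun q => C.m (some p, some q)) (by rw [← hleft p]; exact le_add_self)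
  simp only [filter_filter] at hR
  set Q : Fin N → Option (ℝ × ℝ) := fun i => (F i).bind fun p => R p i with hQ
  have hRQ : ∀ p q, #{i | F i = some p ∧ Q i = some q} = C.m (some p, some q) := fun p q => by
    rw [← hR p q]
    congr 1
    ext i
    simp +contextual [hQ]
  have hQB : ∀ q, #{i | Q i = some q} + C.m (none, some q) = B.mult q := fun q => by
    have h1 := ENNReal.tsum_card_filter_eq_some ({i | Q i = some q} : Finset (Fin N)) F
    have h2 : ({i ∈ ({i | Q i = some q} : Finset (Fin N)) | (F i).isSome}) =
        ({i | Q i = some q} : Finset (Fin N)) := by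
      refine filter_true_of_mem fun i hi => ?_
      rw [mem_filter_univ] at hi
      cases hFi : F i with
      | none => simp [hQ, hFi] at hi
      | some p => rfl
    have h3 := C.right q
    rw [ENNReal.tsum_option] at h3
    simp only [filter_filter, and_comm (a := Q _ = _), hRQ] at h1
    rw [h1] at h3
    rw [filter_filter] at h2
    simp only [and_comm (a := Q _ = _)] at h2
    rw [h2, add_comm] at h3
    exact_mod_cast h3
  have hnone : ∀ i p, F i = some p → Q i = none → C.m (some p, none) ≠ 0 := by
    intro i p hi hQi h0
    have h1 := ENNReal.tsum_card_filter_eq_some ({i | F i = some p} : Finset (Fin N)) Q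
    have h2 := hleft p
    simp only [filter_filter, hRQ] at h1
    rw [h0, Nat.cast_zero, zero_add, h1, Nat.cast_inj, ← filter_filter, card_filter_eq_iff] at h2
    simpa [hQi] using h2 i (by simpa using hi)
  have hfree : ∑' q, (C.m (none, some q) : ℝ≥0∞) ≤ #{i | Q i = none} := by
    have h1 : ∑' q, (#{i | Q i = some q} : ℝ≥0∞) + ∑' q, (C.m (none, some q) : ℝ≥0∞) ≤ N := by
      rw [← ENNReal.tsum_add]
      refine le_trans (le_of_eq (tsum_congr fun q => ?_)) hB
      rw [← hQB q, Nat.cast_add]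
    have h2 : #{i | (Q i).isSome} + #{i | Q i = none} = N := by
      have := card_filter_add_card_filter_not (s := (univ : Finset (Fin N)))
        (fun i => (Q i).isSome)
      simpa using this
    rw [ENNReal.tsum_card_filter_eq_some, ← congrArg (Nat.cast : ℕ → ℝ≥0∞) h2, Nat.cast_add] at h1
    exact (ENNReal.add_le_add_iff_left (by simp)).1 h1
  obtain ⟨R', hR'⟩ := exists_partial_labelling _ _ hfree
  simp only [filter_filter] at hR'
  refine ⟨fun i => if Q i = none then R' i else Q i, fun q => ?_, fun i => ?_⟩
  · rw [← hQB q, ← hR' q, card_filter, card_filter, card_filter, ← sum_add_distrib]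
    refine sum_congr rfl fun i _ => ?_
    by_cases hi : Q i = none <;> simp [hi]
  · beta_reduce
    cases hQi : Q i with
    | none =>
      refine .inr ⟨?_, ?_⟩
      · cases hFi : F i with
        | none => simp [optCost]
        | some p => exact hcost _ _ (hnone i p hFi hQi)
      · rw [if_pos rfl]
        cases hRi : R' i with
        | none => simp [optCost]
        | some q =>
          refine hcost _ _ ?_
          rw [← hR' q]
          exact card_ne_zero.2 ⟨i, by simp [hQi, hRi]⟩
    | some q =>
      left
      rw [if_neg (by simp)]
      cases hFi : F i with
      | none => simp [hQ, hFi] at hQi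
      | some p =>
        refine hcost _ _ ?_
        rw [← hRQ p q]
        exact card_ne_zero.2 ⟨i, by simp [hQi, hFi]⟩

/-- Completeness of the space of possibly empty intervals. -/
theorem exists_optClose_limit {x : ℕ → Option (ℝ × ℝ)}
    (hx : ∀ k p, x k = some p → IsBarInterval p)
    (hcauchy : ∀ ε : ℝ≥0∞, 0 < ε → ∃ K, ∀ k m, K ≤ k → K ≤ m → OptClose ε (x k) (x m)) :
    ∃ y : Option (ℝ × ℝ), (∀ p, y = some p → IsBarInterval p) ∧
      ∀ ε : ℝ≥0∞, 0 < ε → ∃ K, ∀ k, K ≤ k → OptClose ε (x k) y := by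
  by_cases hsmall : ∀ ε : ℝ≥0∞, 0 < ε → ∀ K, ∃ k, K ≤ k ∧ optCost (x k) none ≤ ε
  · refine ⟨none, by simp, fun ε hε => ?_⟩
    obtain ⟨K, hK⟩ := hcauchy (ε / 2) (ENNReal.half_pos hε.ne')
    obtain ⟨k₀, hk₀, hk₀'⟩ := hsmall (ε / 2) (ENNReal.half_pos hε.ne') K
    refine ⟨K, fun k hk => ?_⟩
    simpa using (hK k k₀ hk hk₀).trans (OptClose.trans (.inl hk₀') (.refl 0 none))
  · push Not at hsmall
    obtain ⟨ε₀, hε₀, K₀, hK₀⟩ := hsmall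
    have hsome : ∀ k, ∃ p, x (k + K₀) = some p := fun k => by
      have := hK₀ (k + K₀) le_add_self
      cases hk : x (k + K₀) with
      | none => simp [hk, optCost] at this
      | some p => exact ⟨p, rfl⟩
    choose p hp using hsome
    have hpc : CauchySeq p := by
      refine EMetric.cauchySeq_iff.2 fun ε hε => ?_
      obtain ⟨δ, hδ, hδε⟩ := exists_between (lt_min hε hε₀)
      obtain ⟨K, hK⟩ := hcauchy δ hδ
      refine ⟨K, fun k hk m hm => ?_⟩
      have h := hK (k + K₀) (m + K₀) (by omega) (by omega)
      have hk' := hK₀ (k + K₀) le_add_self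
      rcases h with h | ⟨h, -⟩
      · rw [hp, hp, optCost_some_some] at h
        exact h.trans_lt (hδε.trans_le (min_le_left _ _))
      · exact absurd (h.trans_lt (hδε.trans_le (min_le_right _ _))) hk'.not_gt
    obtain ⟨q, hq⟩ := cauchySeq_tendsto_of_complete hpc
    refine ⟨some q, ?_, fun ε hε => ?_⟩
    · rintro _ ⟨⟩
      have h1 : Filter.Tendsto (fun k => (p k).1) Filter.atTop (nhds q.1) :=
        (continuous_fst.tendsto q).comp hq
      have h2 : Filter.Tendsto (fun k => ENNReal.ofReal (((p k).2 - (p k).1) / 2)) Filter.atTop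
          (nhds (ENNReal.ofReal ((q.2 - q.1) / 2))) :=
        (Continuous.tendsto (f := fun p : ℝ × ℝ => ENNReal.ofReal ((p.2 - p.1) / 2))
          (ENNReal.continuous_ofReal.comp (by fun_prop)) q).comp hq
      refine ⟨ge_of_tendsto' h1 fun k => (hx _ _ (hp k)).1, ?_⟩
      have h3 : ε₀ ≤ ENNReal.ofReal ((q.2 - q.1) / 2) := ge_of_tendsto' h2 fun k => by
        have := hK₀ (k + K₀) le_add_self
        rw [hp] at this
        exact this.le
      have h4 := ENNReal.ofReal_pos.1 (hε₀.trans_le h3)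
      linarith
    · obtain ⟨K, hK⟩ := EMetric.tendsto_atTop.1 hq ε hε
      refine ⟨K + K₀, fun k hk => .inl ?_⟩
      obtain ⟨j, rfl⟩ : ∃ j, k = j + K₀ := ⟨k - K₀, by omega⟩
      rw [hp, optCost_some_some]
      exact (hK j (by omega)).le

open Finset in
theorem exists_memBN_isListedBy {N : ℕ} (H : Fin N → Option (ℝ × ℝ))
    (hH : ∀ i p, H i = some p → IsBarInterval p) :
    ∃ L : ExtBarcode, L.memBN N ∧ L.IsListedBy H := by
  have hex : ∀ p, #{i | H i = some p} ≠ 0 → ∃ i, H i = some p := fun p hp => by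
    obtain ⟨i, hi⟩ := card_ne_zero.1 hp
    exact ⟨i, by simpa using hi⟩
  refine ⟨⟨fun p => #{i | H i = some p}, fun p hp => ?_, fun ε _ => ?_⟩, ?_, fun p => rfl⟩
  · obtain ⟨i, hi⟩ := hex p hp
    exact hH i p hi
  · refine (Set.Finite.preimage (Option.some_injective _).injOn (Set.finite_range H)).subset ?_
    rintro p ⟨hp, -⟩
    exact hex p hp
  · refine (ENNReal.tsum_card_filter_eq_some univ H).le.trans ?_
    exact_mod_cast (card_filter_le _ _).trans (card_fin N).le

theorem OptClose.of_geometric {x : ℕ → Option (ℝ × ℝ)}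
    (hx : ∀ k, OptClose (2⁻¹ ^ k) (x k) (x (k + 1))) (d : ℕ) :
    ∀ k, OptClose (2 * 2⁻¹ ^ k) (x k) (x (k + d)) := by
  induction d with
  | zero => exact fun k => .refl _ _
  | succ d ih =>
    intro k
    have h := (hx k).trans (ih (k + 1))
    have h2 : (2 : ℝ≥0∞) * 2⁻¹ ^ (k + 1) = 2⁻¹ ^ k := by
      rw [pow_succ', ← mul_assoc, ENNReal.mul_inv_cancel two_ne_zero ENNReal.ofNat_ne_top, one_mul]
    rw [h2, ← two_mul] at h
    rwa [show k + (d + 1) = k + 1 + d by ring]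

/-- any Cauchy sequence of barcodes in `B_N` (barcodes with at most `N`
intervals) converges in the bottleneck metric to a barcode in `B_N`. -/
theorem cauchySeq_BN_converges (N : ℕ) (u : ℕ → ExtBarcode) (hu : ∀ n, (u n).memBN N)
    (hcauchy : ∀ ε : ℝ≥0∞, 0 < ε →
      ∃ M : ℕ, ∀ m n : ℕ, M ≤ m → M ≤ n → bottleneckDist (u m) (u n) < ε) :
    ∃ L : ExtBarcode, L.memBN N ∧
      ∀ ε : ℝ≥0∞, 0 < ε → ∃ M : ℕ, ∀ n : ℕ, M ≤ n → bottleneckDist (u n) L < ε := by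
  choose M hM using fun k : ℕ => hcauchy (2⁻¹ ^ k) (ENNReal.pow_pos (by simp) k)
  set n : ℕ → ℕ := fun k => ∑ j ∈ Finset.range (k + 1), M j with hn
  have hMn : ∀ k, M k ≤ n k := fun k =>
    Finset.single_le_sum (fun _ _ => Nat.zero_le _) (Finset.self_mem_range_succ k)
  have hn_succ : ∀ k, n k ≤ n (k + 1) := fun k => by
    simp only [hn, Finset.sum_range_succ _ (k + 1)]
    exact Nat.le_add_right _ _
  obtain ⟨F₀, hF₀⟩ := (hu (n 0)).exists_isListedBy
  choose! next hnext hclose using fun (k : ℕ) (F : Fin N → Option (ℝ × ℝ))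
      (hF : (u (n k)).IsListedBy F) =>
    hF.exists_optClose (hu (n (k + 1))) (hM k _ _ (hMn k) ((hMn k).trans (hn_succ k)))
  let F : ℕ → Fin N → Option (ℝ × ℝ) := fun k => Nat.rec F₀ next k
  have hF : ∀ k, (u (n k)).IsListedBy (F k) := fun k => by
    induction k with
    | zero => exact hF₀
    | succ k ih => exact hnext k _ ih
  have hgeom : ∀ i k d, OptClose (2 * 2⁻¹ ^ k) (F k i) (F (k + d) i) := fun i k d =>
    OptClose.of_geometric (x := fun k => F k i) (fun k => hclose k _ (hF k) i) d k
  have hpow : ∀ ε : ℝ≥0∞, 0 < ε → ∃ K : ℕ, 2⁻¹ ^ K < ε := fun ε hε =>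
    ENNReal.exists_inv_two_pow_lt hε.ne'
  have hlim := fun i => exists_optClose_limit (x := fun k => F k i)
    (fun k p hp => (hF k).isBarInterval hp) fun ε hε => by
      obtain ⟨K, hK⟩ := hpow (ε / 2 / 2)
        (ENNReal.half_pos (ENNReal.half_pos hε.ne').ne')
      have hK' : 2 * 2⁻¹ ^ K ≤ ε / 2 := by
        rw [← ENNReal.add_halves (ε / 2), ← two_mul]
        gcongr
      refine ⟨K, fun k m hk hm => ?_⟩
      obtain ⟨a, rfl⟩ := Nat.exists_eq_add_of_le hk
      obtain ⟨b, rfl⟩ := Nat.exists_eq_add_of_le hm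
      rw [← ENNReal.add_halves ε]
      exact ((hgeom i K a).mono hK').symm.trans ((hgeom i K b).mono hK')
  choose H hH hFH using hlim
  obtain ⟨L, hLN, hL⟩ := exists_memBN_isListedBy H hH
  refine ⟨L, hLN, fun ε hε => ?_⟩
  obtain ⟨ε', hε', hε'ε⟩ := exists_between hε
  have hhalf := ENNReal.half_pos hε'.ne'
  obtain ⟨K₁, hK₁⟩ := hpow _ hhalf
  choose K hK using fun i => hFH i _ hhalf
  set k := K₁ + ∑ i, K i with hk
  have hkK : ∀ i, K i ≤ k := fun i =>
    (Finset.single_le_sum (fun _ _ => Nat.zero_le _) (Finset.mem_univ i)).trans le_add_self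
  have hkε : 2⁻¹ ^ k ≤ ε' / 2 :=
    (pow_le_pow_right_of_le_one' (by simp) le_self_add).trans hK₁.le
  refine ⟨n k, fun m hm => ?_⟩
  obtain ⟨G, hG, hFG⟩ :=
    (hF k).exists_optClose (hu m) (hM k _ _ (hMn k) ((hMn k).trans hm))
  refine (bottleneckDist_le_of_optClose hG hL fun i => ?_).trans_lt hε'ε
  rw [← ENNReal.add_halves ε']
  exact ((hFG i).mono hkε).symm.trans (hK i k (hkK i))
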